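/- Let d ≥ 1 and p ≥ 1 be integers, let T₀ = {x ∈ ℝᵈ : xᵢ ≥ 0 for all i and x₁ + ⋯ + x_d ≤ 1} be the standard unit d-simplex, and let r₁,…,r_q ∈ T₀ with positive weights ω₁,…,ω_q > 0 form a quadrature rule that is exact for polynomials of total degree at most 2p−2, i.e., for every real polynomial ψ in d variables of total degree ≤ 2p−2, Σ_{k=1}^q ψ(r_k) ω_k = ∫_{T₀} ψ(z) dz. If U is a real polynomial in d variables of total degree at most p whose gradient vanishes at each quadrature point, i.e., all first partial derivatives of U evaluate to 0 at every r_k, then U is a constant polynomial. -/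

import Mathlib

open MeasureTheory

namespace MvPolynomial

/-- Partial differentiation lowers the total degree by at least one. -/
theorem totalDegree_pderiv_le_sub_one {σ R : Type*} [CommSemiring R] (i : σ)
    (P : MvPolynomial σ R) : (pderiv i P).totalDegree ≤ P.totalDegree - 1 := by
  refine Finset.sup_le fun m hm => ?_
  rw [mem_support_iff, coeff_pderiv] at hm
  have h := le_totalDegree (mem_support_iff.mpr (left_ne_zero_of_mul hm))
  rw [Finsupp.sum_add_index' (fun _ => rfl) (fun _ _ _ => rfl),
    Finsupp.sum_single_index rfl] at h
  lia

/-- In characteristic zero, a polynomial with vanishing partial derivatives is constant. -/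
theorem eq_C_of_pderiv_eq_zero {σ R : Type*} [CommRing R] [IsDomain R] [CharZero R]
    {P : MvPolynomial σ R} (h : ∀ i, pderiv i P = 0) : P = C (coeff 0 P) := by
  classical
  ext m
  rw [coeff_C]
  split_ifs with hm
  · rw [hm]
  · obtain ⟨i, hi⟩ := Finsupp.ne_iff.mp (Ne.symm hm)
    have hle : Finsupp.single i 1 ≤ m := by
      rw [Finsupp.single_le_iff]
      exact Nat.one_le_iff_ne_zero.mpr hi
    have hc := coeff_pderiv (i := i) P (m - Finsupp.single i 1)
    rw [h i, coeff_zero, tsub_add_cancel_of_le hle] at hc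
    exact (mul_eq_zero.mp hc.symm).resolve_right (by norm_cast)

/-- A real polynomial vanishing almost everywhere on a set with nonempty interior is zero. -/
theorem eq_zero_of_ae_restrict_eq_zero {σ : Type*} [Fintype σ] {P : MvPolynomial σ ℝ}
    {s : Set (σ → ℝ)} {a b : ℝ} (hab : a < b)
    (hs : Set.pi Set.univ (fun _ => Set.Ioo a b) ⊆ s)
    (h : (fun x => eval x P) =ᵐ[volume.restrict s] 0) : P = 0 := by
  refine funext_set (fun _ => Set.Ioo a b) (fun _ => Set.Ioo_infinite hab) fun x hx => ?_
  rw [map_zero]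
  exact Measure.eqOn_open_of_ae_eq (ae_restrict_of_ae_restrict_of_subset hs h)
    (isOpen_set_pi Set.finite_univ fun _ _ => isOpen_Ioo)
    (continuous_eval P).continuousOn continuousOn_const hx

end MvPolynomial

/-- The standard unit simplex is compact. -/
theorem isCompact_unitSimplex (ι : Type*) [Fintype ι] :
    IsCompact {x : ι → ℝ | (∀ i, 0 ≤ x i) ∧ ∑ i, x i ≤ 1} := by
  refine (isCompact_Icc (a := (0 : ι → ℝ)) (b := 1)).of_isClosed_subset ?_ ?_
  · refine IsClosed.inter (s₁ := {x : ι → ℝ | ∀ i, 0 ≤ x i}) ?_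
      (isClosed_le (f := fun x : ι → ℝ => ∑ i, x i) (by fun_prop) continuous_const)
    simp only [Set.ofPred_forall]
    exact isClosed_iInter fun i => isClosed_le continuous_const (continuous_apply i)
  · rintro x ⟨h0, h1⟩
    exact ⟨h0, fun i =>
      (Finset.single_le_sum (fun j _ => h0 j) (Finset.mem_univ i)).trans h1⟩

/-- The standard unit simplex contains a nonempty open cube. -/
theorem pi_Ioo_subset_unitSimplex (ι : Type*) [Fintype ι] :
    Set.pi Set.univ (fun _ : ι => Set.Ioo (0 : ℝ) (1 / (Fintype.card ι + 1))) ⊆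
      {x : ι → ℝ | (∀ i, 0 ≤ x i) ∧ ∑ i, x i ≤ 1} := by
  intro x hx
  refine ⟨fun i => (hx i trivial).1.le, ?_⟩
  calc ∑ i, x i ≤ ∑ _i : ι, (1 / (Fintype.card ι + 1) : ℝ) :=
        Finset.sum_le_sum fun i _ => (hx i trivial).2.le
    _ = Fintype.card ι / (Fintype.card ι + 1) := by simp [div_eq_mul_inv]
    _ ≤ 1 := div_le_one_of_le₀ (by linarith) (by positivity)

/-- Let `T₀` be the standard unit `d`-simplex and let
`(r₁,ω₁),…,(r_q,ω_q)` be a quadrature rule on `T₀` with positive weights that is exact for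
polynomials of total degree at most `2p−2`.  If `U` is a real polynomial in `d` variables of
total degree at most `p` whose gradient vanishes at every quadrature point, then `U` is a
constant polynomial. -/
theorem polynomial_const_of_grad_vanishes_at_quadrature
    {d p q : ℕ} (hd : 1 ≤ d) (hp : 1 ≤ p)
    (r : Fin q → (Fin d → ℝ)) (ω : Fin q → ℝ)
    (hr : ∀ k, (∀ i, 0 ≤ r k i) ∧ ∑ i, r k i ≤ 1)
    (hω : ∀ k, 0 < ω k)
    (hexact : ∀ ψ : MvPolynomial (Fin d) ℝ, ψ.totalDegree ≤ 2 * p - 2 →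
      ∑ k, MvPolynomial.eval (r k) ψ * ω k =
        ∫ z in {x : Fin d → ℝ | (∀ i, 0 ≤ x i) ∧ ∑ i, x i ≤ 1},
          MvPolynomial.eval z ψ)
    (U : MvPolynomial (Fin d) ℝ) (hU : U.totalDegree ≤ p)
    (hgrad : ∀ k i, MvPolynomial.eval (r k) (MvPolynomial.pderiv i U) = 0) :
    ∃ c : ℝ, U = MvPolynomial.C c := by
  refine ⟨_, MvPolynomial.eq_C_of_pderiv_eq_zero fun i => ?_⟩
  set V := MvPolynomial.pderiv i U
  have hV : (V ^ 2).totalDegree ≤ 2 * p - 2 := by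
    have h₁ := MvPolynomial.totalDegree_pow V 2
    have h₂ : V.totalDegree ≤ _ := MvPolynomial.totalDegree_pderiv_le_sub_one i U
    lia
  have hint := hexact (V ^ 2) hV
  simp only [map_pow, V, hgrad, ne_eq, OfNat.ofNat_ne_zero, not_false_eq_true, zero_pow,
    zero_mul, Finset.sum_const_zero] at hint
  have hcont : Continuous fun z => MvPolynomial.eval z V ^ 2 :=
    (MvPolynomial.continuous_eval V).pow 2
  have hae := (integral_eq_zero_iff_of_nonneg (fun z => sq_nonneg (MvPolynomial.eval z V))
    (hcont.continuousOn.integrableOn_compact (isCompact_unitSimplex (Fin d)))).mp hint.symm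
  refine MvPolynomial.eq_zero_of_ae_restrict_eq_zero (by positivity)
    (pi_Ioo_subset_unitSimplex (Fin d)) ?_
  filter_upwards [hae] with z hz
  exact pow_eq_zero_iff two_ne_zero |>.mp hz
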